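/- arXiv:math/0604061 — 2 statements merged into one kernel-verified Lean document; each statement's English description precedes it below -/
import Mathlib

section
/- Let G be a Garside group with Garside element Δ and set 𝒟 of simple elements, and let g ∈ G. Then: (i) if inf_s(g) ≥ 0, then t_𝒟(g) = t_sup(g); (ii) if sup_s(g) ≤ 0, then t_𝒟(g) = −t_inf(g); (iii) if inf_s(g) < 0 < sup_s(g), then t_𝒟(g) = t_len(g). -/
open Filter Topology Pointwise

/-- Left divisibility order on a group relative to a submonoid `P` of positive elements:
`a ≤_L b` iff `a⁻¹ * b ∈ P`. -/
def leL {G : Type*} [Group G] (P : Submonoid G) (a b : G) : Prop := a⁻¹ * b ∈ P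

/-- Right divisibility order: `a ≤_R b` iff `b * a⁻¹ ∈ P`. -/
def leR {G : Type*} [Group G] (P : Submonoid G) (a b : G) : Prop := b * a⁻¹ ∈ P

/-- An atom of the positive monoid `P`: a nontrivial element admitting no nontrivial
factorization inside `P`. -/
def IsMonAtom {G : Type*} [Group G] (P : Submonoid G) (a : G) : Prop :=
  a ∈ P ∧ a ≠ 1 ∧ ∀ b c : G, b ∈ P → c ∈ P → a = b * c → b = 1 ∨ c = 1

/-- `a` can be written as a product of `n` atoms of `P`. -/
def IsAtomProd {G : Type*} [Group G] (P : Submonoid G) (n : ℕ) (a : G) : Prop :=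
  ∃ l : List G, l.length = n ∧ (∀ x ∈ l, IsMonAtom P x) ∧ l.prod = a

/-- A Garside structure on a group `G`: `G` is the group of fractions of the positive
monoid `P`, which is a finitely generated atomic monoid (with atomic norm `norm`),
a lattice for both `≤_L` and `≤_R`, equipped with a Garside element `Δ` whose left and
right divisors coincide and generate `P`.  The fields `zinf`, `zsup`, `infs`, `sups`,
`tinf`, `tsup` are the (uniquely determined) invariants
`inf g = max {r : Δ^r ≤_L g}`, `sup g = min {s : g ≤_L Δ^s}`,
`inf_s g = max {inf h : h ∈ [g]}`, `sup_s g = min {sup h : h ∈ [g]}`,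
`t_inf g = lim inf(gⁿ)/n` and `t_sup g = lim sup(gⁿ)/n`,
each given together with its defining specification. -/
structure GarsideGroup (G : Type*) [Group G] where
  P : Submonoid G
  /-- `G` is the group of fractions of `P`. -/
  fraction : ∀ g : G, ∃ a b : G, a ∈ P ∧ b ∈ P ∧ g = a⁻¹ * b
  /-- `P` is finitely generated. -/
  fg : P.FG
  /-- the atomic norm `‖·‖` -/
  norm : G → ℕ
  /-- `P` is atomic: every positive element is a product of atoms and `norm a` is the
  greatest length of such an expression. -/
  norm_spec : ∀ a ∈ P, IsGreatest {n : ℕ | IsAtomProd P n a} (norm a)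
  /-- `(P, ≤_L)` is a lattice: gcd's and lcm's exist. -/
  latticeL : ∀ a ∈ P, ∀ b ∈ P,
    (∃ c ∈ P, leL P c a ∧ leL P c b ∧ ∀ d ∈ P, leL P d a → leL P d b → leL P d c) ∧
    (∃ c ∈ P, leL P a c ∧ leL P b c ∧ ∀ d ∈ P, leL P a d → leL P b d → leL P c d)
  /-- `(P, ≤_R)` is a lattice. -/
  latticeR : ∀ a ∈ P, ∀ b ∈ P,
    (∃ c ∈ P, leR P c a ∧ leR P c b ∧ ∀ d ∈ P, leR P d a → leR P d b → leR P d c) ∧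
    (∃ c ∈ P, leR P a c ∧ leR P b c ∧ ∀ d ∈ P, leR P a d → leR P b d → leR P c d)
  /-- the Garside element -/
  Δ : G
  Δ_mem : Δ ∈ P
  /-- the left and right divisors of `Δ` coincide -/
  Δ_balanced : ∀ a ∈ P, (leL P a Δ ↔ leR P a Δ)
  /-- the simple elements generate `P` -/
  simples_gen : Submonoid.closure {a : G | a ∈ P ∧ leL P a Δ} = P
  /-- `inf g = max {r : ℤ | Δ^r ≤_L g}` -/
  zinf : G → ℤ
  /-- `sup g = min {s : ℤ | g ≤_L Δ^s}` -/
  zsup : G → ℤ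
  zinf_spec : ∀ g : G, IsGreatest {r : ℤ | leL P (Δ ^ r) g} (zinf g)
  zsup_spec : ∀ g : G, IsLeast {s : ℤ | leL P g (Δ ^ s)} (zsup g)
  /-- `inf_s g = max {inf h : h ∈ [g]}` -/
  infs : G → ℤ
  /-- `sup_s g = min {sup h : h ∈ [g]}` -/
  sups : G → ℤ
  infs_spec : ∀ g : G, IsGreatest (Set.range fun h : G => zinf (h⁻¹ * g * h)) (infs g)
  sups_spec : ∀ g : G, IsLeast (Set.range fun h : G => zsup (h⁻¹ * g * h)) (sups g)
  /-- `t_inf g = lim_{n → ∞} inf(gⁿ)/n` -/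
  tinf : G → ℝ
  /-- `t_sup g = lim_{n → ∞} sup(gⁿ)/n` -/
  tsup : G → ℝ
  tinf_spec : ∀ g : G,
    Filter.Tendsto (fun n : ℕ => (zinf (g ^ n) : ℝ) / (n : ℝ)) Filter.atTop (nhds (tinf g))
  tsup_spec : ∀ g : G,
    Filter.Tendsto (fun n : ℕ => (zsup (g ^ n) : ℝ) / (n : ℝ)) Filter.atTop (nhds (tsup g))

namespace GarsideGroup

variable {G : Type*} [Group G] (Γ : GarsideGroup G)

/-- The set `𝒟` of simple elements. -/
def simples : Set G := {a : G | a ∈ Γ.P ∧ leL Γ.P a Γ.Δ}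

/-- `len g = sup g - inf g` -/
def len (g : G) : ℤ := Γ.zsup g - Γ.zinf g

/-- `t_len g = t_sup g - t_inf g` -/
noncomputable def tlen (g : G) : ℝ := Γ.tsup g - Γ.tinf g

/-- `g` is inf-straight if `inf g = t_inf g`. -/
def InfStraight (g : G) : Prop := (Γ.zinf g : ℝ) = Γ.tinf g

/-- `g` is sup-straight if `sup g = t_sup g`. -/
def SupStraight (g : G) : Prop := (Γ.zsup g : ℝ) = Γ.tsup g

/-- The super summit set `[g]^S`. -/
def superSummit (g : G) : Set G :=
  {h : G | (∃ x : G, x⁻¹ * g * x = h) ∧ Γ.zinf h = Γ.infs g ∧ Γ.zsup h = Γ.sups g}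

end GarsideGroup

/-- The shortest length of a word over the alphabet `X` representing `g`. -/
noncomputable def wlen {G : Type*} [Group G] (X : Set G) (g : G) : ℕ :=
  sInf {n : ℕ | ∃ l : List G, l.length = n ∧ (∀ x ∈ l, x ∈ X) ∧ l.prod = g}

namespace GarsideGroup

section aux

variable {G : Type*} [Group G] (Γ : GarsideGroup G)

theorem conj_inv_mem {p : G} (hp : p ∈ Γ.P) : Γ.Δ⁻¹ * p * Γ.Δ ∈ Γ.P := by
  rw [← Γ.simples_gen] at hp
  induction hp using Submonoid.closure_induction with
  | mem a ha =>
    obtain ⟨ha, h1⟩ := ha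
    have h2 : leR Γ.P (a⁻¹ * Γ.Δ) Γ.Δ := by
      have : Γ.Δ * (a⁻¹ * Γ.Δ)⁻¹ = a := by group
      unfold leR
      rw [this]; exact ha
    have h3 := (Γ.Δ_balanced _ h1).2 h2
    unfold leL at h3
    have : (a⁻¹ * Γ.Δ)⁻¹ * Γ.Δ = Γ.Δ⁻¹ * a * Γ.Δ := by group
    rwa [this] at h3
  | one => simp
  | mul a b _ _ h1 h2 =>
    have := Γ.P.mul_mem h1 h2
    have e : Γ.Δ⁻¹ * a * Γ.Δ * (Γ.Δ⁻¹ * b * Γ.Δ) = Γ.Δ⁻¹ * (a * b) * Γ.Δ := by group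
    rwa [e] at this

theorem conj_mem {p : G} (hp : p ∈ Γ.P) : Γ.Δ * p * Γ.Δ⁻¹ ∈ Γ.P := by
  rw [← Γ.simples_gen] at hp
  induction hp using Submonoid.closure_induction with
  | mem a ha =>
    obtain ⟨ha, h1⟩ := ha
    have h1' : Γ.Δ * a⁻¹ ∈ Γ.P := (Γ.Δ_balanced _ ha).1 h1
    have h2 : leL Γ.P (Γ.Δ * a⁻¹) Γ.Δ := by
      have : (Γ.Δ * a⁻¹)⁻¹ * Γ.Δ = a := by group
      unfold leL
      rw [this]; exact ha
    have h3 := (Γ.Δ_balanced _ h1').1 h2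
    unfold leR at h3
    have : Γ.Δ * (Γ.Δ * a⁻¹)⁻¹ = Γ.Δ * a * Γ.Δ⁻¹ := by group
    rwa [this] at h3
  | one => simp
  | mul a b _ _ h1 h2 =>
    have := Γ.P.mul_mem h1 h2
    have e : Γ.Δ * a * Γ.Δ⁻¹ * (Γ.Δ * b * Γ.Δ⁻¹) = Γ.Δ * (a * b) * Γ.Δ⁻¹ := by group
    rwa [e] at this

theorem conj_zpow_mem (k : ℤ) {p : G} (hp : p ∈ Γ.P) : Γ.Δ ^ k * p * Γ.Δ ^ (-k) ∈ Γ.P := by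
  induction k using Int.induction_on with
  | zero => simpa using hp
  | succ i ih =>
    have := Γ.conj_mem ih
    have e : Γ.Δ * (Γ.Δ ^ (i : ℤ) * p * Γ.Δ ^ (-(i : ℤ))) * Γ.Δ⁻¹
      = Γ.Δ ^ ((i : ℤ) + 1) * p * Γ.Δ ^ (-((i : ℤ) + 1)) := by group
    rwa [e] at this
  | pred i ih =>
    have := Γ.conj_inv_mem ih
    have e : Γ.Δ⁻¹ * (Γ.Δ ^ (-(i : ℤ)) * p * Γ.Δ ^ (-(-(i : ℤ)))) * Γ.Δ
      = Γ.Δ ^ (-(i : ℤ) - 1) * p * Γ.Δ ^ (-(-(i : ℤ) - 1)) := by group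
    rwa [e] at this

theorem leL_trans {a b c : G} (h1 : leL Γ.P a b) (h2 : leL Γ.P b c) : leL Γ.P a c := by
  have := Γ.P.mul_mem h1 h2
  have e : a⁻¹ * b * (b⁻¹ * c) = a⁻¹ * c := by group
  rwa [e] at this

theorem leL_mul_left (x : G) {a b : G} (h : leL Γ.P a b) : leL Γ.P (x * a) (x * b) := by
  unfold leL at *
  have e : (x * a)⁻¹ * (x * b) = a⁻¹ * b := by group
  rwa [e]

theorem leL_mul_zpow (k : ℤ) {a b : G} (h : leL Γ.P a b) :
    leL Γ.P (a * Γ.Δ ^ k) (b * Γ.Δ ^ k) := by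
  have := Γ.conj_zpow_mem (-k) h
  have e : Γ.Δ ^ (-k) * (a⁻¹ * b) * Γ.Δ ^ (- -k) = (a * Γ.Δ ^ k)⁻¹ * (b * Γ.Δ ^ k) := by group
  rwa [e] at this

/-- meets in `P` are meets in `G` -/
theorem meet_pos {a b : G} (ha : a ∈ Γ.P) (hb : b ∈ Γ.P) :
    ∃ c, ∀ d, leL Γ.P d c ↔ leL Γ.P d a ∧ leL Γ.P d b := by
  obtain ⟨c, _, hca, hcb, hc⟩ := (Γ.latticeL a ha b hb).1
  refine ⟨c, fun d => ⟨fun h => ⟨Γ.leL_trans h hca, Γ.leL_trans h hcb⟩, ?_⟩⟩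
  rintro ⟨hda, hdb⟩
  obtain ⟨m, q, hm, hq, hd⟩ := Γ.fraction d
  obtain ⟨e, _, hea, heb, he⟩ :=
    (Γ.latticeL (m * a) (Γ.P.mul_mem hm ha) (m * b) (Γ.P.mul_mem hm hb)).1
  have hmd : m * d = q := by rw [hd]; group
  have hqe : leL Γ.P q e := by
    apply he q hq
    · rw [← hmd]; exact Γ.leL_mul_left m hda
    · rw [← hmd]; exact Γ.leL_mul_left m hdb
  have hme : leL Γ.P m e := by
    apply he m hm
    · unfold leL; simpa using ha
    · unfold leL; simpa using hb
  have hec : leL Γ.P (m⁻¹ * e) c := by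
    apply hc _ hme
    · have := Γ.leL_mul_left m⁻¹ hea
      simpa using this
    · have := Γ.leL_mul_left m⁻¹ heb
      simpa using this
  rw [hd]
  exact Γ.leL_trans (Γ.leL_mul_left m⁻¹ hqe) hec

theorem meet (a b : G) : ∃ c, ∀ d, leL Γ.P d c ↔ leL Γ.P d a ∧ leL Γ.P d b := by
  obtain ⟨m1, p, hm1, hp, ha⟩ := Γ.fraction a
  obtain ⟨m2, q, hm2, hq, hb⟩ := Γ.fraction (m1 * b)
  have h1 : m2 * m1 * a ∈ Γ.P := by
    have : m2 * m1 * a = m2 * p := by rw [ha]; group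
    rw [this]; exact Γ.P.mul_mem hm2 hp
  have h2 : m2 * m1 * b ∈ Γ.P := by
    have : m2 * m1 * b = q := by rw [mul_assoc, hb]; group
    rw [this]; exact hq
  obtain ⟨c, hc⟩ := Γ.meet_pos h1 h2
  have key : ∀ x y : G, leL Γ.P (m2 * m1 * x) (m2 * m1 * y) ↔ leL Γ.P x y := by
    intro x y
    refine ⟨fun h => ?_, fun h => Γ.leL_mul_left _ h⟩
    have := Γ.leL_mul_left (m2 * m1)⁻¹ h
    simpa only [inv_mul_cancel_left] using this
  refine ⟨(m2 * m1)⁻¹ * c, fun d => ?_⟩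
  rw [← key d, mul_inv_cancel_left, hc, key, key]

theorem leL_refl (a : G) : leL Γ.P a a := by
  unfold leL; simp

theorem meets (g : G) (n : ℕ) : ∃ x, ∀ d, leL Γ.P d x ↔ ∀ i ≤ n, leL Γ.P d (g ^ i) := by
  induction n with
  | zero => exact ⟨1, fun d => by simp⟩
  | succ n ih =>
    obtain ⟨x, hx⟩ := ih
    obtain ⟨y, hy⟩ := Γ.meet x (g ^ (n + 1))
    refine ⟨y, fun d => ?_⟩
    rw [hy, hx]
    constructor
    · rintro ⟨h1, h2⟩ i hi
      rcases Nat.lt_or_ge n i with h | h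
      · have : i = n + 1 := by omega
        rw [this]; exact h2
      · exact h1 i h
    · intro h
      exact ⟨fun i hi => h i (by omega), h _ le_rfl⟩

theorem conj_pos_of_pow (g : G) (n : ℕ) (h : g ^ (n + 1) ∈ Γ.P) :
    ∃ x, x⁻¹ * g * x ∈ Γ.P := by
  obtain ⟨x, hx⟩ := Γ.meets g n
  refine ⟨x, ?_⟩
  have hxx := (hx x).1 (Γ.leL_refl x)
  have h1 : leL Γ.P (g⁻¹ * x) x := by
    rw [hx]
    intro i hi
    have h2 : leL Γ.P x (g ^ (i + 1)) := by
      rcases Nat.lt_or_ge i n with h' | h'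
      · exact hxx _ h'
      · have : i = n := by omega
        subst this
        refine Γ.leL_trans (hxx 0 (Nat.zero_le _)) ?_
        unfold leL; simpa using h
    have := Γ.leL_mul_left g⁻¹ h2
    rwa [pow_succ', inv_mul_cancel_left] at this
  unfold leL at h1
  have e : (g⁻¹ * x)⁻¹ * x = x⁻¹ * g * x := by group
  rwa [e] at h1

theorem zpow_mem_of_nonneg {k : ℤ} (hk : 0 ≤ k) : Γ.Δ ^ k ∈ Γ.P := by
  lift k to ℕ using hk
  rw [zpow_natCast]
  exact Γ.P.pow_mem Γ.Δ_mem _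

theorem zpow_le_zpow {r s : ℤ} (h : r ≤ s) : leL Γ.P (Γ.Δ ^ r) (Γ.Δ ^ s) := by
  unfold leL
  rw [← zpow_neg, ← zpow_add]
  exact Γ.zpow_mem_of_nonneg (by omega)

theorem zinf_le_zsup (g : G) : Γ.zinf g ≤ Γ.zsup g := by
  by_contra hlt
  push Not at hlt
  have h1 : leL Γ.P (Γ.Δ ^ Γ.zinf g) g := (Γ.zinf_spec g).1
  have h2 : leL Γ.P g (Γ.Δ ^ Γ.zsup g) := (Γ.zsup_spec g).1
  have h3 := Γ.leL_mul_zpow (Γ.zinf g - Γ.zsup g) (Γ.leL_trans h1 h2)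
  rw [← zpow_add, ← zpow_add, add_sub_cancel] at h3
  have := (Γ.zinf_spec g).2 (Γ.leL_trans h3 h1)
  omega

theorem zinf_mul (a b : G) : Γ.zinf a + Γ.zinf b ≤ Γ.zinf (a * b) := by
  apply (Γ.zinf_spec (a * b)).2
  have h1 : leL Γ.P (Γ.Δ ^ Γ.zinf a) a := (Γ.zinf_spec a).1
  have h2 : leL Γ.P (Γ.Δ ^ Γ.zinf b) b := (Γ.zinf_spec b).1
  have h3 := Γ.leL_mul_zpow (Γ.zinf b) h1
  rw [← zpow_add] at h3
  exact Γ.leL_trans h3 (Γ.leL_mul_left a h2)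

theorem zsup_mul (a b : G) : Γ.zsup (a * b) ≤ Γ.zsup a + Γ.zsup b := by
  apply (Γ.zsup_spec (a * b)).2
  have h1 : leL Γ.P a (Γ.Δ ^ Γ.zsup a) := (Γ.zsup_spec a).1
  have h2 : leL Γ.P b (Γ.Δ ^ Γ.zsup b) := (Γ.zsup_spec b).1
  have h3 := Γ.leL_mul_zpow (Γ.zsup b) h1
  rw [← zpow_add] at h3
  exact Γ.leL_trans (Γ.leL_mul_left a h2) h3

theorem zinf_nonneg_iff (g : G) : 0 ≤ Γ.zinf g ↔ g ∈ Γ.P := by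
  constructor
  · intro h
    have h1 : leL Γ.P (Γ.Δ ^ Γ.zinf g) g := (Γ.zinf_spec g).1
    have := Γ.leL_trans (Γ.zpow_le_zpow h) h1
    simpa [leL] using this
  · intro h
    apply (Γ.zinf_spec g).2
    simpa [leL] using h

theorem zsup_nonpos_iff (g : G) : Γ.zsup g ≤ 0 ↔ g⁻¹ ∈ Γ.P := by
  constructor
  · intro h
    have h1 : leL Γ.P g (Γ.Δ ^ Γ.zsup g) := (Γ.zsup_spec g).1
    have := Γ.leL_trans h1 (Γ.zpow_le_zpow h)
    simpa [leL] using this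
  · intro h
    apply (Γ.zsup_spec g).2
    simpa [leL] using h

/-- positive elements below `Δ^s` are products of `s` simples -/
theorem word_pos (s : ℕ) : ∀ g ∈ Γ.P, leL Γ.P g (Γ.Δ ^ (s : ℤ)) →
    ∃ l : List G, l.length = s ∧ (∀ x ∈ l, x ∈ Γ.simples) ∧ l.prod = g := by
  induction s with
  | zero =>
    intro g hg h
    refine ⟨[], rfl, by simp, ?_⟩
    have h' : g⁻¹ ∈ Γ.P := by simpa [leL] using h
    obtain ⟨l1, hn1, ha1, hp1⟩ := (Γ.norm_spec g hg).1
    obtain ⟨l2, hn2, ha2, hp2⟩ := (Γ.norm_spec g⁻¹ h').1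
    obtain ⟨l3, hn3, ha3, hp3⟩ := (Γ.norm_spec g hg).1
    have : IsAtomProd Γ.P (l1.length + l2.length + l3.length) g :=
      ⟨l1 ++ l2 ++ l3, by simp [add_assoc], by
        intro x hx
        simp only [List.mem_append] at hx
        rcases hx with (hx | hx) | hx
        exacts [ha1 x hx, ha2 x hx, ha3 x hx], by simp [hp1, hp2, hp3]⟩
    have := (Γ.norm_spec g hg).2 this
    have h0 : l1.length = 0 := by omega
    rw [← hp1, List.length_eq_zero_iff.1 h0]
  | succ s ih =>
    intro g hg h
    obtain ⟨x, hx⟩ := Γ.meet g Γ.Δ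
    obtain ⟨hxg, hxΔ⟩ := (hx x).1 (Γ.leL_refl x)
    have hxP : x ∈ Γ.P := by
      have : leL Γ.P 1 x := (hx 1).2 ⟨by simpa [leL] using hg, by simpa [leL] using Γ.Δ_mem⟩
      simpa [leL] using this
    have h1 : leL Γ.P (g * Γ.Δ ^ (-(s : ℤ))) x := by
      rw [hx]
      constructor
      · unfold leL
        have e : (g * Γ.Δ ^ (-(s : ℤ)))⁻¹ * g = Γ.Δ ^ (s : ℤ) := by group
        rw [e]; exact Γ.zpow_mem_of_nonneg (by omega)
      · have := Γ.leL_mul_zpow (-(s : ℤ)) h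
        rw [← zpow_add] at this
        simpa using this
    have h2 := Γ.leL_mul_left x⁻¹ (Γ.leL_mul_zpow (s : ℤ) h1)
    have e1 : x⁻¹ * (g * Γ.Δ ^ (-(s : ℤ)) * Γ.Δ ^ (s : ℤ)) = x⁻¹ * g := by group
    rw [e1, inv_mul_cancel_left] at h2
    obtain ⟨l, hl, hs, hprod⟩ := ih _ hxg h2
    refine ⟨x :: l, by simp [hl], ?_, by simp [hprod]⟩
    intro y hy
    rcases List.mem_cons.1 hy with rfl | hy
    · exact ⟨hxP, hxΔ⟩
    · exact hs y hy

theorem word_upper (g : G) :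
    ∃ l : List G, l.length = (-Γ.zinf g).toNat + (Γ.zsup g).toNat ∧
      (∀ x ∈ l, x ∈ Γ.simples ∪ Γ.simples⁻¹) ∧ l.prod = g := by
  obtain ⟨c, hc⟩ := Γ.meet g 1
  obtain ⟨hcg, hc1⟩ := (hc c).1 (Γ.leL_refl c)
  have hi : leL Γ.P (Γ.Δ ^ Γ.zinf g) g := (Γ.zinf_spec g).1
  have hs : leL Γ.P g (Γ.Δ ^ Γ.zsup g) := (Γ.zsup_spec g).1
  set r := (-Γ.zinf g).toNat with hr
  set s := (Γ.zsup g).toNat with hsdef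
  have hA : c⁻¹ ∈ Γ.P := by simpa [leL] using hc1
  have hi' : leL Γ.P (Γ.Δ ^ (-(r : ℤ))) c := by
    rw [hc]
    refine ⟨Γ.leL_trans (Γ.zpow_le_zpow (by omega)) hi, ?_⟩
    have := Γ.zpow_le_zpow (r := -(r : ℤ)) (s := 0) (by omega)
    simpa using this
  have hA2 : leL Γ.P c⁻¹ (Γ.Δ ^ (r : ℤ)) := by
    have := Γ.leL_mul_left c⁻¹ (Γ.leL_mul_zpow (r : ℤ) hi')
    have e : c⁻¹ * (Γ.Δ ^ (-(r : ℤ)) * Γ.Δ ^ (r : ℤ)) = c⁻¹ := by group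
    rwa [e, inv_mul_cancel_left] at this
  have hB : leL Γ.P (g * Γ.Δ ^ (-(s : ℤ))) c := by
    rw [hc]
    constructor
    · unfold leL
      have e : (g * Γ.Δ ^ (-(s : ℤ)))⁻¹ * g = Γ.Δ ^ (s : ℤ) := by group
      rw [e]; exact Γ.zpow_mem_of_nonneg (by omega)
    · have := Γ.leL_mul_zpow (-(s : ℤ))
        (Γ.leL_trans hs (Γ.zpow_le_zpow (s := (s : ℤ)) (by omega)))
      rw [← zpow_add] at this
      simpa using this
  have hB2 : leL Γ.P (c⁻¹ * g) (Γ.Δ ^ (s : ℤ)) := by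
    have := Γ.leL_mul_left c⁻¹ (Γ.leL_mul_zpow (s : ℤ) hB)
    have e : c⁻¹ * (g * Γ.Δ ^ (-(s : ℤ)) * Γ.Δ ^ (s : ℤ)) = c⁻¹ * g := by group
    rwa [e, inv_mul_cancel_left] at this
  obtain ⟨l1, hl1, hx1, hp1⟩ := Γ.word_pos r _ hA hA2
  obtain ⟨l2, hl2, hx2, hp2⟩ := Γ.word_pos s _ hcg hB2
  refine ⟨(l1.map (·⁻¹)).reverse ++ l2, by simp [hl1, hl2], ?_, ?_⟩
  · intro x hx
    simp only [List.mem_append, List.mem_reverse, List.mem_map] at hx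
    rcases hx with ⟨a, ha, rfl⟩ | hx
    · right; simpa using hx1 a ha
    · left; exact hx2 x hx
  · rw [List.prod_append, ← List.prod_inv_reverse, hp1, hp2]; group

theorem word_lower (l : List G) : (∀ x ∈ l, x ∈ Γ.simples ∪ Γ.simples⁻¹) →
    ∃ p q : ℕ, p + q = l.length ∧ leL Γ.P (Γ.Δ ^ (-(p : ℤ))) l.prod ∧
      leL Γ.P l.prod (Γ.Δ ^ (q : ℤ)) := by
  induction l with
  | nil => intro _; exact ⟨0, 0, rfl, by simp [leL], by simp [leL]⟩
  | cons x l ih =>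
    intro h
    obtain ⟨p, q, hpq, h1, h2⟩ := ih fun y hy => h y (List.mem_cons_of_mem _ hy)
    have h1' := Γ.leL_mul_left x h1
    have h2' := Γ.leL_mul_left x h2
    rcases h x List.mem_cons_self with ⟨hx, hxΔ⟩ | hx
    · refine ⟨p, q + 1, by simp; omega, ?_, ?_⟩
      · have : leL Γ.P 1 x := by simpa [leL] using hx
        have := Γ.leL_mul_zpow (-(p : ℤ)) this
        rw [one_mul] at this
        simpa using Γ.leL_trans this h1'
      · have := Γ.leL_mul_zpow (q : ℤ) hxΔ
        rw [← zpow_one_add] at this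
        have := Γ.leL_trans h2' this
        rw [List.prod_cons]
        convert this using 2
        push_cast; ring
    · obtain ⟨hx, hxΔ⟩ := hx
      refine ⟨p + 1, q, by simp; omega, ?_, ?_⟩
      · have : leL Γ.P (Γ.Δ ^ (-1 : ℤ)) x := by
          have h3 : leR Γ.P x⁻¹ Γ.Δ := (Γ.Δ_balanced _ hx).1 hxΔ
          simpa [leL, leR] using h3
        have := Γ.leL_mul_zpow (-(p : ℤ)) this
        rw [← zpow_add] at this
        have := Γ.leL_trans this h1'
        rw [List.prod_cons]
        convert this using 2
        push_cast; ring
      · have : leL Γ.P x 1 := by simpa [leL] using hx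
        have := Γ.leL_mul_zpow (q : ℤ) this
        rw [one_mul] at this
        simpa using Γ.leL_trans h2' this

theorem wlen_eq (g : G) :
    wlen (Γ.simples ∪ Γ.simples⁻¹) g = (-Γ.zinf g).toNat + (Γ.zsup g).toNat := by
  apply le_antisymm
  · exact Nat.sInf_le (Γ.word_upper g)
  · refine le_csInf ⟨_, Γ.word_upper g⟩ ?_
    rintro n ⟨l, hl, hx, hp⟩
    obtain ⟨p, q, hpq, h1, h2⟩ := Γ.word_lower l hx
    rw [hp] at h1 h2
    have h1' := (Γ.zinf_spec g).2 h1
    have h2' := (Γ.zsup_spec g).2 h2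
    omega

theorem wlen_tendsto (g : G) :
    Filter.Tendsto
        (fun n : ℕ => (wlen (Γ.simples ∪ Γ.simples⁻¹) (g ^ n) : ℝ) / (n : ℝ))
        Filter.atTop (nhds (max (-Γ.tinf g) 0 + max (Γ.tsup g) 0)) := by
  have h := ((Γ.tinf_spec g).neg.max tendsto_const_nhds (g := fun _ => (0 : ℝ))).add
    ((Γ.tsup_spec g).max (tendsto_const_nhds (x := (0 : ℝ))))
  refine h.congr fun n => ?_
  rw [Γ.wlen_eq]
  have key : ∀ z : ℤ, ((z.toNat : ℕ) : ℝ) = max (z : ℝ) 0 := by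
    intro z
    have : ((z.toNat : ℕ) : ℤ) = max z 0 := Int.ofNat_toNat z
    exact_mod_cast congrArg (Int.cast : ℤ → ℝ) this
  push_cast [key]
  rw [add_div, ← max_div_div_right (Nat.cast_nonneg n), ← max_div_div_right (Nat.cast_nonneg n),
    zero_div, neg_div]

theorem tinf_le_tsup (g : G) : Γ.tinf g ≤ Γ.tsup g := by
  refine le_of_tendsto_of_tendsto' (Γ.tinf_spec g) (Γ.tsup_spec g) fun n => ?_
  have : (Γ.zinf (g ^ n) : ℝ) ≤ Γ.zsup (g ^ n) := by exact_mod_cast Γ.zinf_le_zsup _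
  gcongr

theorem tinf_nonneg (g : G) (h : 0 ≤ Γ.infs g) : 0 ≤ Γ.tinf g := by
  obtain ⟨x, hx⟩ := (Γ.infs_spec g).1
  simp only at hx
  rw [← hx, zinf_nonneg_iff] at h
  refine le_of_tendsto_of_tendsto'
    (tendsto_const_div_atTop_nhds_zero_nat ((Γ.zinf x + Γ.zinf x⁻¹ : ℤ) : ℝ)) (Γ.tinf_spec g)
    fun n => ?_
  have hn := (Γ.zinf_nonneg_iff _).2 (Γ.P.pow_mem h n)
  have e : g ^ n = x * (x⁻¹ * g * x) ^ n * x⁻¹ := by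
    have := conj_pow (a := x⁻¹) (b := g) (i := n)
    rw [inv_inv] at this
    rw [this]; group
  have h1 := Γ.zinf_mul x ((x⁻¹ * g * x) ^ n)
  have h2 := Γ.zinf_mul (x * (x⁻¹ * g * x) ^ n) x⁻¹
  rw [← e] at h2
  have : ((Γ.zinf x + Γ.zinf x⁻¹ : ℤ) : ℝ) ≤ Γ.zinf (g ^ n) := by
    exact_mod_cast (by omega : Γ.zinf x + Γ.zinf x⁻¹ ≤ Γ.zinf (g ^ n))
  gcongr

theorem tsup_nonpos (g : G) (h : Γ.sups g ≤ 0) : Γ.tsup g ≤ 0 := by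
  obtain ⟨x, hx⟩ := (Γ.sups_spec g).1
  simp only at hx
  rw [← hx, zsup_nonpos_iff] at h
  refine le_of_tendsto_of_tendsto' (Γ.tsup_spec g)
    (tendsto_const_div_atTop_nhds_zero_nat ((Γ.zsup x + Γ.zsup x⁻¹ : ℤ) : ℝ))
    fun n => ?_
  have hn := Γ.P.pow_mem h n
  rw [inv_pow, ← zsup_nonpos_iff] at hn
  have e : g ^ n = x * (x⁻¹ * g * x) ^ n * x⁻¹ := by
    have := conj_pow (a := x⁻¹) (b := g) (i := n)
    rw [inv_inv] at this
    rw [this]; group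
  have h1 := Γ.zsup_mul x ((x⁻¹ * g * x) ^ n)
  have h2 := Γ.zsup_mul (x * (x⁻¹ * g * x) ^ n) x⁻¹
  rw [← e] at h2
  have : (Γ.zsup (g ^ n) : ℝ) ≤ ((Γ.zsup x + Γ.zsup x⁻¹ : ℤ) : ℝ) := by
    exact_mod_cast (by omega : Γ.zsup (g ^ n) ≤ Γ.zsup x + Γ.zsup x⁻¹)
  gcongr

theorem tinf_nonpos (g : G) (h : Γ.infs g < 0) : Γ.tinf g ≤ 0 := by
  by_contra hpos
  push Not at hpos
  obtain ⟨n, hn, hn1⟩ := (((Γ.tinf_spec g).eventually_const_lt hpos).and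
    (Filter.eventually_ge_atTop 1)).exists
  obtain ⟨m, rfl⟩ : ∃ m, n = m + 1 := ⟨n - 1, by omega⟩
  have h1 : (0 : ℝ) < Γ.zinf (g ^ (m + 1)) := by
    by_contra hc
    push Not at hc
    exact absurd hn (not_lt.2 (div_nonpos_of_nonpos_of_nonneg hc (Nat.cast_nonneg _)))
  have h2 : 0 < Γ.zinf (g ^ (m + 1)) := by exact_mod_cast h1
  obtain ⟨x, hx⟩ := Γ.conj_pos_of_pow g m ((Γ.zinf_nonneg_iff _).1 h2.le)
  have h3 := (Γ.zinf_nonneg_iff _).2 hx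
  have h4 : Γ.zinf (x⁻¹ * g * x) ≤ Γ.infs g := (Γ.infs_spec g).2 ⟨x, rfl⟩
  omega

theorem tsup_nonneg (g : G) (h : 0 < Γ.sups g) : 0 ≤ Γ.tsup g := by
  by_contra hneg
  push Not at hneg
  obtain ⟨n, hn, hn1⟩ := (((Γ.tsup_spec g).eventually_lt_const hneg).and
    (Filter.eventually_ge_atTop 1)).exists
  obtain ⟨m, rfl⟩ : ∃ m, n = m + 1 := ⟨n - 1, by omega⟩
  have h1 : (Γ.zsup (g ^ (m + 1)) : ℝ) < 0 := by
    by_contra hc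
    push Not at hc
    exact absurd hn (not_lt.2 (div_nonneg hc (Nat.cast_nonneg _)))
  have h2 : Γ.zsup (g ^ (m + 1)) < 0 := by exact_mod_cast h1
  have h2' := (Γ.zsup_nonpos_iff _).1 h2.le
  rw [← inv_pow] at h2'
  obtain ⟨x, hx⟩ := Γ.conj_pos_of_pow g⁻¹ m h2'
  have e : x⁻¹ * g⁻¹ * x = (x⁻¹ * g * x)⁻¹ := by group
  rw [e] at hx
  have h3 := (Γ.zsup_nonpos_iff _).2 hx
  have h4 : Γ.sups g ≤ Γ.zsup (x⁻¹ * g * x) := (Γ.sups_spec g).2 ⟨x, rfl⟩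
  omega

end aux

end GarsideGroup

/-- (i) if `inf_s(g) ≥ 0` then `t_𝒟(g) = t_sup(g)`;
(ii) if `sup_s(g) ≤ 0` then `t_𝒟(g) = -t_inf(g)`;
(iii) if `inf_s(g) < 0 < sup_s(g)` then `t_𝒟(g) = t_len(g)`. -/
theorem statement14 {G : Type*} [Group G] (Γ : GarsideGroup G) (g : G) :
    (0 ≤ Γ.infs g →
      Filter.Tendsto
        (fun n : ℕ => (wlen (Γ.simples ∪ Γ.simples⁻¹) (g ^ n) : ℝ) / (n : ℝ))
        Filter.atTop (nhds (Γ.tsup g))) ∧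
    (Γ.sups g ≤ 0 →
      Filter.Tendsto
        (fun n : ℕ => (wlen (Γ.simples ∪ Γ.simples⁻¹) (g ^ n) : ℝ) / (n : ℝ))
        Filter.atTop (nhds (-Γ.tinf g))) ∧
    (Γ.infs g < 0 → 0 < Γ.sups g →
      Filter.Tendsto
        (fun n : ℕ => (wlen (Γ.simples ∪ Γ.simples⁻¹) (g ^ n) : ℝ) / (n : ℝ))
        Filter.atTop (nhds (Γ.tlen g))) := by
  have h := Γ.wlen_tendsto g
  have hle := Γ.tinf_le_tsup g
  refine ⟨fun h0 => ?_, fun h0 => ?_, fun h0 h1 => ?_⟩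
  · have h2 := Γ.tinf_nonneg g h0
    rwa [max_eq_right (by linarith), max_eq_left (by linarith), zero_add] at h
  · have h2 := Γ.tsup_nonpos g h0
    rwa [max_eq_left (by linarith), max_eq_right (by linarith), add_zero] at h
  · have h2 := Γ.tinf_nonpos g h0
    have h3 := Γ.tsup_nonneg g h1
    rw [max_eq_left (by linarith), max_eq_left h3] at h
    have e : Γ.tlen g = -Γ.tinf g + Γ.tsup g := by unfold GarsideGroup.tlen; ring
    rwa [e]
end

section
/- Let N be a positive integer and let x be a real number such that for every integer k ≥ 1 the fractional part frac(kx) does not lie in the open interval (0, 1/N). Then x is rational and can be written in the form p/q for some integers p, q with 1 ≤ q ≤ N. -/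
/-- if `N ≥ 1` and `x` is a real number such that for every integer
`k ≥ 1` the fractional part of `kx` does not lie in the open interval `(0, 1/N)`,
then `x = p/q` for some integers `p, q` with `1 ≤ q ≤ N`. -/
theorem statement18 (N : ℕ) (hN : 0 < N) (x : ℝ)
    (h : ∀ k : ℤ, 1 ≤ k → Int.fract ((k : ℝ) * x) ∉ Set.Ioo (0 : ℝ) (1 / (N : ℝ))) :
    ∃ p q : ℤ, 1 ≤ q ∧ q ≤ (N : ℤ) ∧ x = (p : ℝ) / (q : ℝ) := by
  have hN1 : (1 : ℝ) ≤ N := by exact_mod_cast hN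
  have hle1 : 1 / (N : ℝ) ≤ 1 := by
    rw [div_le_one (by linarith)]
    exact hN1
  have key : ∀ k j : ℤ, 1 ≤ k → 0 < (k : ℝ) * x - j → (k : ℝ) * x - j < 1 / (N : ℝ) → False := by
    intro k j hk h0 h1
    apply h k hk
    have : Int.fract ((k : ℝ) * x) = (k : ℝ) * x - j := by
      rw [Int.fract_eq_iff]
      exact ⟨h0.le, by linarith, j, by ring⟩
    rw [this]
    exact ⟨h0, h1⟩
  obtain ⟨j, k, hk0, hkN, hjk⟩ := Real.exists_int_int_abs_mul_sub_le x hN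
  have hlt : 1 / ((N : ℝ) + 1) < 1 / (N : ℝ) :=
    one_div_lt_one_div_of_lt (by linarith) (by linarith)
  have hk0' : (0 : ℝ) < k := by exact_mod_cast hk0
  obtain ⟨hl, hu⟩ := abs_le.mp hjk
  rcases lt_trichotomy ((k : ℝ) * x - j) 0 with hneg | hz | hpos
  · exfalso
    obtain ⟨d, hd⟩ : ∃ d : ℝ, d = j - (k : ℝ) * x := ⟨_, rfl⟩
    have hd0 : 0 < d := by linarith
    have hd1 : d < 1 / (N : ℝ) := by linarith
    have hc1 := Int.le_ceil (1 / d)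
    have hc2 := Int.ceil_lt_add_one (1 / d)
    have hm1 : 1 ≤ ⌈1 / d⌉ - 1 := by
      have : 1 < ⌈1 / d⌉ := by
        rw [Int.lt_ceil]
        rw [lt_div_iff₀ hd0]
        push_cast
        linarith
      linarith
    obtain ⟨m, hm⟩ : ∃ m : ℤ, m = ⌈1 / d⌉ - 1 := ⟨_, rfl⟩
    rw [← hm] at hm1
    have hmr : (m : ℝ) = ⌈1 / d⌉ - 1 := by rw [hm]; push_cast; ring
    have ha : (m : ℝ) * d < 1 := by
      rw [← lt_div_iff₀ hd0]
      linarith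
    have hb : 1 ≤ ((m : ℝ) + 1) * d := by
      rw [← div_le_iff₀ hd0]
      linarith
    have he : ((m * k : ℤ) : ℝ) * x - ((m * j - 1 : ℤ) : ℝ) = 1 - m * d := by
      rw [hd]; push_cast; ring
    refine key (m * k) (m * j - 1) (by nlinarith) ?_ ?_
    · rw [he]; linarith
    · rw [he]; linarith
  · refine ⟨j, k, hk0, hkN, ?_⟩
    rw [eq_div_iff hk0'.ne']
    linarith
  · exact (key k j hk0 hpos (by linarith)).elim
end
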